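/- There exists a subgroup G ≤ W of order 60, isomorphic to the semidirect product C₃ ⋊ F₅ (where F₅ = C₅ ⋊ C₄ is the Frobenius group of order 20 acting on C₃ nontrivially through its quotient of order 2), such that: the action of G on the 56 exceptional classes has exactly four orbits, of lengths 6, 10, 10, and 30, with point stabilizers isomorphic to the dihedral group of order 10, the cyclic group of order 6, the cyclic group of order 6, and the cyclic group of order 2 respectively, the stabilizer of order 2 being non-normal in G; G is minimal; G fixes no conic class; and G satisfies condition (H1). -/

import Mathlib

open scoped BigOperators

noncomputable section

/-- The Picard lattice of a degree 2 del Pezzo surface. -/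
abbrev V : Type := Fin 8 → ℤ

/-- The intersection form. -/
def bil (x y : V) : ℤ := x 0 * y 0 - ∑ i ∈ Finset.Ioi (0 : Fin 8), x i * y i

/-- The canonical class. -/
def Kvec : V := fun i => if i = 0 then -3 else 1

abbrev LatAut := V ≃ₗ[ℤ] V

/-- The Weyl group: automorphisms preserving the form and fixing K. -/
def W : Subgroup LatAut where
  carrier := {g | (∀ x y, bil (g x) (g y) = bil x y) ∧ g Kvec = Kvec}
  one_mem' := ⟨fun _ _ => rfl, rfl⟩
  mul_mem' := by
    rintro a b ⟨ha1, ha2⟩ ⟨hb1, hb2⟩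
    refine ⟨fun x y => ?_, ?_⟩
    · show bil (a (b x)) (a (b y)) = bil x y
      rw [ha1, hb1]
    · show a (b Kvec) = Kvec
      rw [hb2, ha2]
  inv_mem' := by
    rintro a ⟨ha1, ha2⟩
    refine ⟨fun x y => ?_, ?_⟩
    · have h := ha1 (a⁻¹ x) (a⁻¹ y)
      have hx : a (a⁻¹ x) = x := a.apply_symm_apply x
      have hy : a (a⁻¹ y) = y := a.apply_symm_apply y
      rw [hx, hy] at h
      exact h.symm
    · have h2 : a.symm (a Kvec) = a.symm Kvec := by rw [ha2]
      rw [a.symm_apply_apply] at h2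
      exact (show a⁻¹ Kvec = a.symm Kvec from rfl).trans h2.symm

/-- Exceptional classes. -/
def Exc : Set V := {E | bil E E = -1 ∧ bil E Kvec = -1}

/-- Conic classes. -/
def IsConic (C : V) : Prop := bil C C = 0 ∧ bil C Kvec = -2

/-- The orbit of a vector under a subgroup of `LatAut`. -/
def orb (G : Subgroup LatAut) (E : V) : Set V := {v | ∃ g ∈ G, g E = v}

/-- The set of orbits of exceptional classes. -/
def orbs (G : Subgroup LatAut) : Set (Set V) := {S | ∃ E ∈ Exc, S = orb G E}

/-- The stabilizer of a vector, as a subgroup of `LatAut`. -/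
def stab (G : Subgroup LatAut) (E : V) : Subgroup LatAut where
  carrier := {g | g ∈ G ∧ g E = E}
  one_mem' := ⟨G.one_mem, rfl⟩
  mul_mem' := by
    rintro a b ⟨haG, ha⟩ ⟨hbG, hb⟩
    exact ⟨G.mul_mem haG hbG, by show a (b E) = E; rw [hb, ha]⟩
  inv_mem' := by
    rintro a ⟨haG, ha⟩
    refine ⟨G.inv_mem haG, ?_⟩
    conv_lhs => rw [← ha]
    exact a.symm_apply_apply E

/-- `G` is minimal: no nonempty orbit of exceptional classes consists of pairwise
orthogonal classes. -/
def MinimalAction (G : Subgroup LatAut) : Prop :=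
  ∀ E ∈ Exc, ¬ (∀ E₁ ∈ orb G E, ∀ E₂ ∈ orb G E, E₁ ≠ E₂ → bil E₁ E₂ = 0)

/-- The natural representation of a subgroup of `LatAut` on the lattice. -/
def rep (G : Subgroup LatAut) : Representation ℤ G V where
  toFun g := (g : LatAut).toLinearMap
  map_one' := rfl
  map_mul' _ _ := rfl

/-- Condition (H1): the first group cohomology of every subgroup of `G`
with coefficients in the lattice vanishes. -/
def CondH1 (G : Subgroup LatAut) : Prop :=
  ∀ G' : Subgroup LatAut, G' ≤ G →
    Subsingleton (groupCohomology.H1 (Rep.of (rep G')))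

theorem bil_eq (x y : V) : bil x y = x 0 * y 0 - (x 1 * y 1 + x 2 * y 2 + x 3 * y 3 + x 4 * y 4
    + x 5 * y 5 + x 6 * y 6 + x 7 * y 7) := by
  have h : Finset.Ioi (0 : Fin 8) = {1, 2, 3, 4, 5, 6, 7} := by decide
  simp [bil, h, add_assoc]

/-- The cyclic permutation of the last three exceptional curves, of order 3. -/
def genA : LatAut where
  toFun x := ![x 0, x 1, x 2, x 3, x 4, x 7, x 5, x 6]
  invFun x := ![x 0, x 1, x 2, x 3, x 4, x 6, x 7, x 5]
  map_add' x y := by ext i; fin_cases i <;> rfl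
  map_smul' r x := by ext i; fin_cases i <;> rfl
  left_inv x := by ext i; fin_cases i <;> rfl
  right_inv x := by ext i; fin_cases i <;> rfl

/-- An element of order 5 in the Weyl group of the `A₄` subsystem with simple roots
`e₁ - e₂`, `e₂ - e₃`, `e₃ - e₄`, `e₀ - e₁ - e₂ - e₃`. -/
def genB : LatAut where
  toFun x := ![2 * x 0 + x 1 + x 2 + x 4, x 3, -x 0 - x 2 - x 4, -x 0 - x 1 - x 2,
    -x 0 - x 1 - x 4, x 5, x 6, x 7]
  invFun x := ![2 * x 0 + x 2 + x 3 + x 4, -x 0 - x 3 - x 4, -x 0 - x 2 - x 3, x 1,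
    -x 0 - x 2 - x 4, x 5, x 6, x 7]
  map_add' x y := by ext i; fin_cases i <;> simp <;> ring
  map_smul' r x := by ext i; fin_cases i <;> simp <;> ring
  left_inv x := by ext i; fin_cases i <;> simp <;> ring
  right_inv x := by ext i; fin_cases i <;> simp <;> ring

/-- The degree `-⟨x, K⟩` of a class. -/
def deg (x : V) : ℤ := 3 * x 0 + x 1 + x 2 + x 3 + x 4 + x 5 + x 6 + x 7

/-- The composite of the Geiser involution with the permutation `(1 2 3 4)(5 6)` of the
exceptional curves, of order 4. -/
def genC : LatAut where
  toFun x := ![3 * deg x - x 0, -deg x - x 4, -deg x - x 1, -deg x - x 2, -deg x - x 3,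
    -deg x - x 6, -deg x - x 5, -deg x - x 7]
  invFun x := ![3 * deg x - x 0, -deg x - x 2, -deg x - x 3, -deg x - x 4, -deg x - x 1,
    -deg x - x 6, -deg x - x 5, -deg x - x 7]
  map_add' x y := by ext i; fin_cases i <;> simp [deg] <;> ring
  map_smul' r x := by ext i; fin_cases i <;> simp [deg] <;> ring
  left_inv x := by ext i; fin_cases i <;> simp [deg] <;> ring
  right_inv x := by ext i; fin_cases i <;> simp [deg] <;> ring

theorem genA_mem_W : genA ∈ W := by
  refine ⟨fun x y => ?_, ?_⟩
  · simp [bil_eq, genA]; ring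
  · ext i; fin_cases i <;> simp [genA, Kvec]

theorem genB_mem_W : genB ∈ W := by
  refine ⟨fun x y => ?_, ?_⟩
  · simp [bil_eq, genB]; ring
  · ext i; fin_cases i <;> simp [genB, Kvec]

theorem genC_mem_W : genC ∈ W := by
  refine ⟨fun x y => ?_, ?_⟩
  · simp [bil_eq, genC, deg]; ring
  · ext i; fin_cases i <;> simp [genC, deg, Kvec]

theorem latAut_ext {g h : LatAut} (H : ∀ i, g (Pi.single i 1) = h (Pi.single i 1)) : g = h :=
  LinearEquiv.toLinearMap_injective <| LinearMap.pi_ext' fun i => LinearMap.ext_ring (H i)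

theorem genA_pow_three : genA ^ 3 = 1 := latAut_ext (by decide +kernel)

theorem genB_pow_five : genB ^ 5 = 1 := latAut_ext (by decide +kernel)

theorem genC_pow_four : genC ^ 4 = 1 := latAut_ext (by decide +kernel)

theorem commute_genB_genA : Commute genB genA := latAut_ext (by decide +kernel)

theorem semiconjBy_genC_genA : SemiconjBy genC genA (genA ^ 2) := latAut_ext (by decide +kernel)

theorem semiconjBy_genC_genB : SemiconjBy genC genB (genB ^ 2) := latAut_ext (by decide +kernel)

/-- Multiplication by a unit, as an automorphism of the cyclic group of order `n`. -/
def scale {n : ℕ} (u : (ZMod n)ˣ) : MulAut (Multiplicative (ZMod n)) where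
  toFun x := .ofAdd (u * x.toAdd)
  invFun x := .ofAdd (↑u⁻¹ * x.toAdd)
  left_inv x := by simp
  right_inv x := by simp
  map_mul' x y := by simp [mul_add]

theorem scale_mul {n : ℕ} (u v : (ZMod n)ˣ) : scale (u * v) = scale u * scale v := by
  ext x; simp [scale, mul_assoc]

/-- The faithful action of the cyclic group of order 4 on the cyclic group of order 5. -/
def psi : Multiplicative (ZMod 4) →* MulAut (Multiplicative (ZMod 5)) :=
  MonoidHom.mk' (fun k : Multiplicative (ZMod 4) =>
    scale ((⟨2, 3, by decide, by decide⟩ : (ZMod 5)ˣ) ^ k.toAdd.val)) fun k l => by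
    rw [← scale_mul]; congr 1; revert k l; decide

/-- The action of the Frobenius group of order 20 on the cyclic group of order 3 by sign. -/
def chi : Multiplicative (ZMod 5) ⋊[psi] Multiplicative (ZMod 4) →*
    MulAut (Multiplicative (ZMod 3)) :=
  (MonoidHom.mk' (fun k : Multiplicative (ZMod 4) =>
    scale ((⟨2, 2, by decide, by decide⟩ : (ZMod 3)ˣ) ^ k.toAdd.val)) fun k l => by
    rw [← scale_mul]; congr 1; revert k l; decide).comp SemidirectProduct.rightHom

theorem psi_injective : Function.Injective psi := by
  intro k l h
  replace h := DFunLike.congr_fun h (.ofAdd 1)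
  revert k l; decide

theorem chi_ne_one : chi ≠ 1 := by
  intro h
  replace h := DFunLike.congr_fun (DFunLike.congr_fun h (.inr (.ofAdd 1))) (.ofAdd 1)
  revert h; decide

/-- The abstract group `C₃ ⋊ F₅`. -/
abbrev C3F5 : Type :=
  Multiplicative (ZMod 3) ⋊[chi] (Multiplicative (ZMod 5) ⋊[psi] Multiplicative (ZMod 4))

instance : Fintype C3F5 :=
  .ofEquiv (ZMod 3 × ZMod 5 × ZMod 4) {
    toFun t := ⟨.ofAdd t.1, ⟨.ofAdd t.2.1, .ofAdd t.2.2⟩⟩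
    invFun h := (h.left.toAdd, h.right.left.toAdd, h.right.right.toAdd)
    left_inv _ := rfl
    right_inv _ := rfl }

theorem SemiconjBy.pow_pow_of_pow {M : Type*} [Monoid M] {c a : M} {m : ℕ}
    (h : SemiconjBy c a (a ^ m)) (k n : ℕ) : c ^ k * a ^ n = a ^ (m ^ k * n) * c ^ k := by
  induction k generalizing n with
  | zero => simp
  | succ k ih =>
    rw [pow_succ c, mul_assoc, (h.pow_right n).eq, ← pow_mul, ← mul_assoc, ih, mul_assoc]
    ring_nf

/-- The action of `C₃ ⋊ F₅` on the Picard lattice. -/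
def rho : C3F5 →* LatAut :=
  MonoidHom.mk' (fun h => genA ^ h.left.toAdd.val * genB ^ h.right.left.toAdd.val *
    genC ^ h.right.right.toAdd.val) fun g h => by
    obtain ⟨i, j, k⟩ := g
    obtain ⟨i', j', k'⟩ := h
    have hA : genA ^ (i * chi ⟨j, k⟩ i').toAdd.val =
        genA ^ i.toAdd.val * genA ^ (2 ^ k.toAdd.val * i'.toAdd.val) := by
      rw [← pow_add]
      refine pow_eq_pow_of_modEq ?_ genA_pow_three
      change _ = _
      clear j'
      revert i j k i'; decide
    have hB : genB ^ (j * psi k j').toAdd.val =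
        genB ^ j.toAdd.val * genB ^ (2 ^ k.toAdd.val * j'.toAdd.val) := by
      rw [← pow_add]
      refine pow_eq_pow_of_modEq ?_ genB_pow_five
      change _ = _
      clear hA i i'
      revert j k j'; decide
    have hC : genC ^ (k * k').toAdd.val = genC ^ k.toAdd.val * genC ^ k'.toAdd.val := by
      rw [← pow_add]
      refine pow_eq_pow_of_modEq ?_ genC_pow_four
      change _ = _
      clear hA hB i i' j j'
      revert k k'; decide
    have hCA := semiconjBy_genC_genA.pow_pow_of_pow k.toAdd.val i'.toAdd.val
    have hCB := semiconjBy_genC_genB.pow_pow_of_pow k.toAdd.val j'.toAdd.val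
    have hBA := (commute_genB_genA.pow_pow j.toAdd.val (2 ^ k.toAdd.val * i'.toAdd.val)).eq
    simp only [SemidirectProduct.mul_def, hA, hB, hC, mul_assoc]
    rw [← mul_assoc (genC ^ _) (genA ^ _), hCA, mul_assoc, ← mul_assoc (genC ^ _) (genB ^ _), hCB,
      mul_assoc, ← mul_assoc (genB ^ j.toAdd.val) (genA ^ _), hBA, mul_assoc]

theorem rho_mem_W (h : C3F5) : rho h ∈ W :=
  W.mul_mem (W.mul_mem (W.pow_mem genA_mem_W _) (W.pow_mem genB_mem_W _)) (W.pow_mem genC_mem_W _)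

theorem rho_mem_range (h : C3F5) : rho h ∈ rho.range := ⟨h, rfl⟩

/-- Representatives of the four orbits of exceptional classes. -/
def excRep : Fin 4 → V :=
  ![![0, 0, 0, 0, 0, 0, 0, 1], ![0, 0, 0, 0, 1, 0, 0, 0], ![0, 0, 0, 1, 0, 0, 0, 0],
    ![1, -1, 0, 0, 0, -1, 0, 0]]

/-- The smaller of the two values that the coordinates other than `x 0` of an exceptional class
with `x 0 = d` can take. -/
def excFloor : Fin 4 → ℤ := ![0, -1, -1, -2]

/-- The classes with `x 0 = d` whose other coordinates take the two values that occur in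
exceptional classes. -/
def excCandidate (d : Fin 4) (s : Fin 7 → Bool) : V :=
  Fin.cons (d : ℤ) fun i => excFloor d + if s i then 1 else 0

theorem excCandidate_eq_rho_excRep : ∀ (d : Fin 4) (s : Fin 7 → Bool),
    ∑ i, excCandidate d s (Fin.succ i) ^ 2 = (d : ℤ) ^ 2 + 1 →
    ∑ i, excCandidate d s (Fin.succ i) = 1 - 3 * (d : ℤ) →
    ∃ h q, rho h (excRep q) = excCandidate d s := by
  decide +kernel

theorem sum_sq_of_mem_Exc {E : V} (hE : E ∈ Exc) : ∑ i, E (Fin.succ i) ^ 2 = E 0 ^ 2 + 1 := by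
  have h := hE.1
  rw [bil_eq] at h
  rw [Fin.sum_univ_seven]
  simp only [Fin.reduceSucc]
  linarith

theorem sum_of_mem_Exc {E : V} (hE : E ∈ Exc) : ∑ i, E (Fin.succ i) = 1 - 3 * E 0 := by
  have h := hE.2
  rw [bil_eq] at h
  simp only [Kvec, if_pos, Fin.reduceEq, if_false] at h
  rw [Fin.sum_univ_seven]
  simp only [Fin.reduceSucc]
  linarith

theorem exists_eq_excCandidate {E : V} (hE : E ∈ Exc) : ∃ d s, E = excCandidate d s := by
  have hsq := sum_sq_of_mem_Exc hE
  have hsum := sum_of_mem_Exc hE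
  have hexpand (t : ℤ) : ∑ i, (E (Fin.succ i) - t) * (E (Fin.succ i) - t - 1) =
      E 0 ^ 2 + 1 - (2 * t + 1) * (1 - 3 * E 0) + 7 * (t * (t + 1)) := by
    rw [← hsq, ← hsum, Finset.mul_sum, ← Finset.sum_sub_distrib]
    have : (7 : ℤ) * (t * (t + 1)) = ∑ _i : Fin 7, t * (t + 1) := by simp
    rw [this, ← Finset.sum_add_distrib]
    exact Finset.sum_congr rfl fun i _ => by ring
  have hcauchy : 0 ≤ ∑ i, (7 * E (Fin.succ i) - (1 - 3 * E 0)) ^ 2 :=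
    Finset.sum_nonneg fun i _ => sq_nonneg _
  have hcauchy' : ∑ i, (7 * E (Fin.succ i) - (1 - 3 * E 0)) ^ 2 =
      49 * (E 0 ^ 2 + 1) - 7 * (1 - 3 * E 0) ^ 2 := by
    rw [← hsq, ← hsum]
    simp only [Fin.sum_univ_seven]
    ring
  have h0 : 0 ≤ E 0 := by nlinarith
  have h3 : E 0 ≤ 3 := by nlinarith
  obtain ⟨d, hd⟩ : ∃ d : Fin 4, E 0 = d := ⟨⟨(E 0).toNat, by omega⟩, by simp [h0]⟩
  have hzero : ∑ i, (E (Fin.succ i) - excFloor d) * (E (Fin.succ i) - excFloor d - 1) = 0 := by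
    rw [hexpand, hd]
    clear hexpand hcauchy hcauchy' hd
    revert d; decide
  have hnonneg (i : Fin 7) :
      0 ≤ (E (Fin.succ i) - excFloor d) * (E (Fin.succ i) - excFloor d - 1) := by
    rcases le_or_gt (E (Fin.succ i) - excFloor d) 0 with h | h
    · exact mul_nonneg_of_nonpos_of_nonpos h (by omega)
    · exact mul_nonneg h.le (by omega)
  refine ⟨d, fun i => E (Fin.succ i) = excFloor d + 1, funext fun j => ?_⟩
  cases j using Fin.cases with
  | zero => exact hd
  | succ i =>
    have h := (Finset.sum_eq_zero_iff_of_nonneg fun i _ => hnonneg i).1 hzero i (Finset.mem_univ i)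
    simp only [excCandidate, Fin.cons_succ, decide_eq_true_eq]
    rcases mul_eq_zero.1 h with h | h <;> split_ifs <;> omega

theorem exists_rho_excRep {E : V} (hE : E ∈ Exc) : ∃ h q, rho h (excRep q) = E := by
  obtain ⟨d, s, rfl⟩ := exists_eq_excCandidate hE
  exact excCandidate_eq_rho_excRep d s (sum_sq_of_mem_Exc hE) (sum_of_mem_Exc hE)

theorem excRep_mem_Exc (q : Fin 4) : excRep q ∈ Exc := by
  simp only [Exc, Set.mem_ofPred_eq, bil_eq]
  revert q; decide +kernel

theorem eq_of_rho_excRep_eq_excRep :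
    ∀ q r h, rho h (excRep q) = excRep r → q = r := by
  decide +kernel

theorem orb_eq_of_mem {G : Subgroup LatAut} {g : LatAut} (hg : g ∈ G) (E : V) :
    orb G (g E) = orb G E := by
  ext v
  constructor
  · rintro ⟨k, hk, rfl⟩
    exact ⟨k * g, G.mul_mem hk hg, rfl⟩
  · rintro ⟨k, hk, rfl⟩
    exact ⟨k * g⁻¹, G.mul_mem hk (G.inv_mem hg), by simp⟩

theorem orb_range_rho (E : V) :
    orb rho.range E = ↑(Finset.univ.image fun h => rho h E) := by
  ext v; simp [orb]

theorem ncard_orb_excRep (q : Fin 4) :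
    (orb rho.range (excRep q)).ncard = (![6, 10, 10, 30] : Fin 4 → ℕ) q := by
  rw [orb_range_rho, Set.ncard_coe_finset]
  revert q; decide +kernel

theorem orb_excRep_injective : Function.Injective fun q => orb rho.range (excRep q) := by
  intro q r h
  obtain ⟨_, ⟨k, rfl⟩, hk⟩ : excRep r ∈ orb rho.range (excRep q) := by
    rw [show orb rho.range (excRep q) = _ from h]
    exact ⟨1, one_mem _, rfl⟩
  exact eq_of_rho_excRep_eq_excRep q r k hk

theorem orbs_range_rho : orbs rho.range = Set.range fun q => orb rho.range (excRep q) := by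
  ext S
  constructor
  · rintro ⟨E, hE, rfl⟩
    obtain ⟨h, q, rfl⟩ := exists_rho_excRep hE
    exact ⟨q, (orb_eq_of_mem (rho_mem_range h) _).symm⟩
  · rintro ⟨q, rfl⟩
    exact ⟨_, excRep_mem_Exc q, rfl⟩

theorem ncard_orbs_of_ncard (n : ℕ) : {S ∈ orbs rho.range | S.ncard = n}.ncard =
    (Finset.univ.filter fun q : Fin 4 => (![6, 10, 10, 30] : Fin 4 → ℕ) q = n).card := by
  rw [← Set.ncard_coe_finset, ← Set.ncard_image_of_injective _ orb_excRep_injective,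
    orbs_range_rho]
  congr 1
  ext S
  simp only [Set.mem_ofPred_eq, Set.mem_range, Set.mem_image, Finset.coe_filter,
    Finset.mem_univ, true_and]
  constructor
  · rintro ⟨⟨q, rfl⟩, h⟩
    exact ⟨q, ncard_orb_excRep q ▸ h, rfl⟩
  · rintro ⟨q, h, rfl⟩
    exact ⟨⟨q, rfl⟩, (ncard_orb_excRep q).trans h⟩

theorem ncard_orbs : (orbs rho.range).ncard = 4 := by
  rw [orbs_range_rho, ← Set.image_univ, Set.ncard_image_of_injective _ orb_excRep_injective]
  simp

theorem stab_eq_map_conj {G : Subgroup LatAut} {g : LatAut} (hg : g ∈ G) (E : V) :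
    stab G (g E) = (stab G E).map (MulAut.conj g).toMonoidHom := by
  ext k
  simp only [Subgroup.mem_map, MulEquiv.coe_toMonoidHom, MulAut.conj_apply]
  constructor
  · rintro ⟨hk, hkE⟩
    refine ⟨g⁻¹ * k * g, ⟨G.mul_mem (G.mul_mem (G.inv_mem hg) hk) hg, ?_⟩, by group⟩
    simp only [LinearEquiv.mul_apply, hkE]
    exact g.symm_apply_apply E
  · rintro ⟨l, ⟨hl, hlE⟩, rfl⟩
    refine ⟨G.mul_mem (G.mul_mem hg hl) (G.inv_mem hg), ?_⟩
    have h : g⁻¹ (g E) = E := g.symm_apply_apply E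
    simp only [LinearEquiv.mul_apply, h, hlE]

/-- Stabilizers of vectors in the same orbit are conjugate, hence isomorphic. -/
def stabEquiv {G : Subgroup LatAut} {g : LatAut} (hg : g ∈ G) (E : V) :
    stab G (g E) ≃* stab G E :=
  (MulEquiv.subgroupCongr (stab_eq_map_conj hg E)).trans
    ((MulAut.conj g).subgroupMap (stab G E)).symm

theorem rho_injective : Function.Injective rho := by
  rw [injective_iff_map_eq_one]
  intro h hh
  have key : ∀ h, rho h (excRep 0) = excRep 0 → rho h (excRep 1) = excRep 1 →
      rho h (excRep 3) = excRep 3 → h = 1 := by decide +kernel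
  exact key h (by rw [hh]; rfl) (by rw [hh]; rfl) (by rw [hh]; rfl)

theorem nonempty_stab_mulEquiv {K : Type*} [Group K] (f : K →* C3F5) (hf : Function.Injective f)
    (E : V) (hE : ∀ h, rho h E = E ↔ ∃ k, f k = h) : Nonempty (stab rho.range E ≃* K) := by
  have h : stab rho.range E = (rho.comp f).range := by
    ext g
    constructor
    · rintro ⟨⟨h, rfl⟩, hh⟩
      obtain ⟨k, rfl⟩ := (hE h).1 hh
      exact ⟨k, rfl⟩
    · rintro ⟨k, rfl⟩
      exact ⟨⟨f k, rfl⟩, (hE _).2 ⟨k, rfl⟩⟩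
  have hinj : Function.Injective (rho.comp f) := rho_injective.comp hf
  exact ⟨(MulEquiv.subgroupCongr h).trans (MonoidHom.ofInjective hinj).symm⟩

/-- The homomorphism from the dihedral group of order 10 onto the stabilizer of `excRep 0`. -/
def dihedralHom : DihedralGroup 5 →* C3F5 :=
  MonoidHom.mk' (fun
    | .r i => ⟨1, ⟨.ofAdd i, 1⟩⟩
    | .sr i => ⟨1, ⟨.ofAdd (-i), .ofAdd 2⟩⟩) (by decide +kernel)

/-- The homomorphism from the cyclic group of order `n` with prescribed image of the generator. -/
def zmodPowHom {M : Type*} [Group M] {n : ℕ} [NeZero n] (x : M) (hx : x ^ n = 1) :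
    Multiplicative (ZMod n) →* M :=
  MonoidHom.mk' (fun k => x ^ k.toAdd.val) fun k l => by
    rw [← pow_add]
    refine pow_eq_pow_of_modEq ?_ hx
    rw [toAdd_mul, ZMod.val_add]
    exact Nat.mod_modEq _ _

theorem nonempty_stab_excRep_zero :
    Nonempty (stab rho.range (excRep 0) ≃* DihedralGroup 5) :=
  nonempty_stab_mulEquiv dihedralHom (by unfold Function.Injective; decide +kernel) _
    (by decide +kernel)

theorem nonempty_stab_excRep_one :
    Nonempty (stab rho.range (excRep 1) ≃* Multiplicative (ZMod 6)) :=
  nonempty_stab_mulEquiv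
    (zmodPowHom ⟨.ofAdd 1, ⟨.ofAdd 3, .ofAdd 2⟩⟩ (by decide +kernel))
    (by unfold Function.Injective; decide +kernel) _ (by decide +kernel)

theorem nonempty_stab_excRep_two :
    Nonempty (stab rho.range (excRep 2) ≃* Multiplicative (ZMod 6)) :=
  nonempty_stab_mulEquiv
    (zmodPowHom ⟨.ofAdd 1, ⟨.ofAdd 4, .ofAdd 2⟩⟩ (by decide +kernel))
    (by unfold Function.Injective; decide +kernel) _ (by decide +kernel)

theorem nonempty_stab_excRep_three :
    Nonempty (stab rho.range (excRep 3) ≃* Multiplicative (ZMod 2)) :=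
  nonempty_stab_mulEquiv
    (zmodPowHom ⟨1, ⟨.ofAdd 2, .ofAdd 2⟩⟩ (by decide +kernel))
    (by unfold Function.Injective; decide +kernel) _ (by decide +kernel)

theorem exists_conj_notMem_stab_excRep_three : ∃ g ∈ rho.range,
    ∃ h ∈ stab rho.range (excRep 3), g * h * g⁻¹ ∉ stab rho.range (excRep 3) := by
  have key : ∃ g h, rho h (excRep 3) = excRep 3 ∧
      rho (g * h * g⁻¹) (excRep 3) ≠ excRep 3 := by decide +kernel
  obtain ⟨g, h, hh, hgh⟩ := key
  refine ⟨rho g, ⟨g, rfl⟩, rho h, ⟨⟨h, rfl⟩, hh⟩, fun hmem => hgh ?_⟩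
  simpa using hmem.2

theorem exists_conj_notMem_stab {G : Subgroup LatAut} {k : LatAut} (hk : k ∈ G) {E : V}
    (hE : ∃ g ∈ G, ∃ h ∈ stab G E, g * h * g⁻¹ ∉ stab G E) :
    ∃ g ∈ G, ∃ h ∈ stab G (k E), g * h * g⁻¹ ∉ stab G (k E) := by
  obtain ⟨g, hg, h, hh, hgh⟩ := hE
  refine ⟨k * g * k⁻¹, G.mul_mem (G.mul_mem hk hg) (G.inv_mem hk), k * h * k⁻¹, ?_, ?_⟩
  · rw [stab_eq_map_conj hk]
    exact ⟨h, hh, rfl⟩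
  · rw [stab_eq_map_conj hk]
    rintro ⟨l, hl, hlg⟩
    refine hgh ?_
    have : l = g * h * g⁻¹ := by
      refine (MulAut.conj k).injective ?_
      simp only [MulEquiv.coe_toMonoidHom, MulAut.conj_apply] at hlg ⊢
      rw [hlg]
      group
    exact this ▸ hl

theorem stab_of_mem_Exc {E : V} (hE : E ∈ Exc) :
    ((orb rho.range E).ncard = 6 → Nonempty (stab rho.range E ≃* DihedralGroup 5)) ∧
    ((orb rho.range E).ncard = 10 →
      IsCyclic (stab rho.range E) ∧ Nat.card (stab rho.range E) = 6) ∧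
    ((orb rho.range E).ncard = 30 → Nat.card (stab rho.range E) = 2 ∧
      ∃ g ∈ rho.range, ∃ h ∈ stab rho.range E, g * h * g⁻¹ ∉ stab rho.range E) := by
  obtain ⟨h, q, rfl⟩ := exists_rho_excRep hE
  have hmem := rho_mem_range h
  have cyclic {q : Fin 4} (e : Nonempty (stab rho.range (excRep q) ≃* Multiplicative (ZMod 6))) :
      IsCyclic (stab rho.range (rho h (excRep q))) ∧
        Nat.card (stab rho.range (rho h (excRep q))) = 6 := by
    obtain ⟨e⟩ := e
    have e' := (stabEquiv hmem _).trans e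
    exact ⟨e'.isCyclic.2 inferInstance, (Nat.card_congr e'.toEquiv).trans (by simp)⟩
  rw [orb_eq_of_mem hmem, ncard_orb_excRep]
  fin_cases q
  · exact ⟨fun _ => nonempty_stab_excRep_zero.map (stabEquiv hmem _).trans,
      fun h => absurd h (by decide), fun h => absurd h (by decide)⟩
  · exact ⟨fun h => absurd h (by decide), fun _ => cyclic nonempty_stab_excRep_one,
      fun h => absurd h (by decide)⟩
  · exact ⟨fun h => absurd h (by decide), fun _ => cyclic nonempty_stab_excRep_two,
      fun h => absurd h (by decide)⟩
  · refine ⟨fun h => absurd h (by decide), fun h => absurd h (by decide), fun _ => ⟨?_, ?_⟩⟩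
    · obtain ⟨e⟩ := nonempty_stab_excRep_three
      exact (Nat.card_congr ((stabEquiv hmem _).trans e).toEquiv).trans (by simp)
    · exact exists_conj_notMem_stab hmem exists_conj_notMem_stab_excRep_three

theorem minimalAction_range_rho : MinimalAction rho.range := by
  intro E hE hort
  obtain ⟨h, q, rfl⟩ := exists_rho_excRep hE
  rw [orb_eq_of_mem (rho_mem_range h)] at hort
  have key : ∀ q, ∃ g, excRep q ≠ rho g (excRep q) ∧ bil (excRep q) (rho g (excRep q)) ≠ 0 := by
    simp only [bil_eq]
    decide +kernel
  obtain ⟨g, hne, hg⟩ := key q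
  exact hg (hort _ ⟨1, one_mem _, rfl⟩ _ ⟨_, ⟨g, rfl⟩, rfl⟩ hne)

theorem card_C3F5 : Nat.card C3F5 = 60 := by
  rw [Nat.card_eq_fintype_card]
  rfl

theorem genA_mem_range_rho : genA ∈ rho.range := ⟨⟨.ofAdd 1, 1⟩, latAut_ext (by decide +kernel)⟩

theorem genB_mem_range_rho : genB ∈ rho.range :=
  ⟨⟨1, ⟨.ofAdd 1, 1⟩⟩, latAut_ext (by decide +kernel)⟩

theorem genC_mem_range_rho : genC ∈ rho.range :=
  ⟨⟨1, ⟨1, .ofAdd 1⟩⟩, latAut_ext (by decide +kernel)⟩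

theorem eq_zsmul_Kvec_of_fixed {C : V} (hC : ∀ g ∈ rho.range, g C = C) : C = C 7 • Kvec := by
  have hA := congr_fun (hC _ genA_mem_range_rho)
  have hB := congr_fun (hC _ genB_mem_range_rho)
  have hC := congr_fun (hC _ genC_mem_range_rho)
  simp only [Fin.forall_fin_succ, genA, genB, genC, deg, LinearEquiv.coe_mk,
    LinearMap.coe_mk, AddHom.coe_mk] at hA hB hC
  simp at hA hB hC
  ext i
  fin_cases i <;> simp [Kvec] <;> omega

theorem not_exists_fixed_conic : ¬ ∃ C, IsConic C ∧ ∀ g ∈ rho.range, g C = C := by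
  rintro ⟨C, ⟨h0, h2⟩, hfix⟩
  rw [eq_zsmul_Kvec_of_fixed hfix, bil_eq] at h0 h2
  simp [Kvec] at h0 h2
  have : C 7 = 0 := by nlinarith
  omega

theorem bil_add_right (x y z : V) : bil x (y + z) = bil x y + bil x z := by
  simp only [bil_eq, Pi.add_apply]; ring

theorem bil_smul_right (n : ℤ) (x y : V) : bil x (n • y) = n * bil x y := by
  simp only [bil_eq, Pi.smul_apply, smul_eq_mul]; ring

theorem sum_bil_smul_eq_of_single (X : Finset (V × V))
    (hX : ∀ i, ∑ p ∈ X, bil p.1 (Pi.single i 1) • p.2 = Pi.single i 1) (x : V) :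
    ∑ p ∈ X, bil p.1 x • p.2 = x := by
  let L : V →ₗ[ℤ] V :=
    { toFun x := ∑ p ∈ X, bil p.1 x • p.2
      map_add' x y := by simp only [bil_add_right, add_smul, Finset.sum_add_distrib]
      map_smul' n x := by
        simp only [bil_smul_right, mul_smul, Finset.smul_sum, RingHom.id_apply] }
  have hL : L = LinearMap.id := LinearMap.pi_ext' fun i => LinearMap.ext_ring (hX i)
  exact LinearMap.congr_fun hL x

/-- If the identity of the lattice decomposes as a sum of rank one maps `x ↦ ⟨w, x⟩ v` over a
`G`-stable finite set of pairs `(w, v)`, then the lattice is a direct summand of a permutation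
lattice, so its first cohomology vanishes. -/
theorem subsingleton_H1_of_frame (G : Subgroup LatAut) [Finite G] (hW : G ≤ W)
    (X : Finset (V × V)) (hX : ∀ g ∈ G, ∀ p ∈ X, (g p.1, g p.2) ∈ X)
    (hres : ∀ x, ∑ p ∈ X, bil p.1 x • p.2 = x) :
    Subsingleton (groupCohomology.H1 (Rep.of (rep G))) := by
  have := Fintype.ofFinite G
  refine subsingleton_of_forall_eq 0 fun y => ?_
  induction y using groupCohomology.H1_induction_on with
  | h f =>
  rw [groupCohomology.H1π_eq_zero_iff]
  have hf : ∀ g h : G, f (g * h) = (g : LatAut) (f h) + f g :=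
    (groupCohomology.mem_cocycles₁_iff f).1 f.2
  set n : ℤ := ((Fintype.card G : ℕ) : ℤ) with hn
  have hn0 : n ≠ 0 := by simp [hn]
  let s : V := ∑ h : G, (f h : V)
  have hs (g : G) : s = (g : LatAut) s + n • (f g : V) := by
    calc s = ∑ h : G, (f (g * h) : V) := (Equiv.sum_comp (Equiv.mulLeft g) fun h => (f h : V)).symm
      _ = ∑ h : G, ((g : LatAut) (f h) + (f g : V)) := Finset.sum_congr rfl fun h _ => hf g h
      _ = _ := by simp [s, Finset.sum_add_distrib, hn]
  let u : V := ∑ p ∈ X, (bil p.1 s / n) • p.2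
  have hu (g : G) : u = (g : LatAut) u + f g := by
    have hsum : ∑ p ∈ X, (bil p.1 ((g : LatAut) s) / n) • p.2 = (g : LatAut) u := by
      symm
      rw [show (g : LatAut) u = ∑ p ∈ X, (g : LatAut) ((bil p.1 s / n) • p.2) from map_sum _ _ _]
      refine Finset.sum_bij (fun p _ => ((g : LatAut) p.1, (g : LatAut) p.2)) (hX g g.2) ?_ ?_ ?_
      · intro p _ q _ h
        simpa [Prod.ext_iff] using h
      · intro p hp
        refine ⟨_, hX _ (G.inv_mem g.2) p hp, ?_⟩
        exact Prod.ext ((g : LatAut).apply_symm_apply _) ((g : LatAut).apply_symm_apply _)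
      · intro p _
        rw [(hW g.2).1, map_zsmul]
    calc u = ∑ p ∈ X, ((bil p.1 ((g : LatAut) s) / n) • p.2 + bil p.1 (f g) • p.2) := by
          refine Finset.sum_congr rfl fun p _ => ?_
          conv_lhs => rw [hs g, bil_add_right, bil_smul_right, Int.add_mul_ediv_left _ _ hn0]
          rw [add_smul]
      _ = _ := by rw [Finset.sum_add_distrib, hsum, hres]
  refine ⟨-u, funext fun g => ?_⟩
  change (g : LatAut) (-u) - -u = f g
  conv_lhs => rw [sub_neg_eq_add, map_neg]; arg 2; rw [hu g]
  exact neg_add_cancel_left _ _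

/-- A stable set of pairs of classes, consisting of one orbit of each of the lengths 1, 6, 10. -/
def frame : Finset (V × V) :=
  {(Kvec, 4 • Kvec)} ∪
    (Finset.univ.image fun h =>
      (rho h ![0, 0, 0, 0, 0, 1, 0, 0], rho h ![0, 0, 0, 0, 0, 0, 1, 0])) ∪
    Finset.univ.image fun h =>
      (rho h ![0, 0, 1, 0, 1, 0, 0, 0], rho h ![-1, 1, 0, 1, 0, 0, 0, 0])

theorem frame_stable : ∀ g ∈ rho.range, ∀ p ∈ frame, (g p.1, g p.2) ∈ frame := by
  rintro _ ⟨h, rfl⟩ p hp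
  simp only [frame, Finset.mem_union, Finset.mem_singleton, Finset.mem_image, Finset.mem_univ,
    true_and] at hp ⊢
  obtain (rfl | ⟨k, rfl⟩) | ⟨k, rfl⟩ := hp
  · exact .inl (.inl (by rw [map_nsmul, (rho_mem_W h).2]))
  · exact .inl (.inr ⟨h * k, by simp⟩)
  · exact .inr ⟨h * k, by simp⟩

theorem sum_frame_single : ∀ i, ∑ p ∈ frame, bil p.1 (Pi.single i 1) • p.2 = Pi.single i 1 := by
  decide +kernel

theorem condH1_range_rho : CondH1 rho.range := by
  intro G hG
  have : Finite G := ((Set.finite_range rho).subset hG).to_subtype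
  refine subsingleton_H1_of_frame G ?_ frame (fun g hg => frame_stable g (hG hg))
    (sum_bil_smul_eq_of_single frame sum_frame_single)
  intro g hg
  obtain ⟨h, rfl⟩ := hG hg
  exact rho_mem_W h

theorem exists_dp2_C3F5 :
    ∃ G : Subgroup LatAut, G ≤ W ∧ Nat.card G = 60 ∧
      (∃ (ψ : Multiplicative (ZMod 4) →* MulAut (Multiplicative (ZMod 5)))
      (χ : (Multiplicative (ZMod 5) ⋊[ψ] Multiplicative (ZMod 4)) →* MulAut (Multiplicative (ZMod 3))),
      Function.Injective ψ ∧ χ ≠ 1 ∧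
      Nonempty (G ≃* Multiplicative (ZMod 3) ⋊[χ] (Multiplicative (ZMod 5) ⋊[ψ] Multiplicative (ZMod 4)))) ∧
      (orbs G).ncard = 4 ∧
      {S ∈ orbs G | S.ncard = 6}.ncard = 1 ∧
      {S ∈ orbs G | S.ncard = 10}.ncard = 2 ∧
      {S ∈ orbs G | S.ncard = 30}.ncard = 1 ∧
      (∀ E ∈ Exc,
        ((orb G E).ncard = 6 → Nonempty (stab G E ≃* DihedralGroup 5)) ∧
        ((orb G E).ncard = 10 → IsCyclic (stab G E) ∧ Nat.card (stab G E) = 6) ∧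
        ((orb G E).ncard = 30 → Nat.card (stab G E) = 2 ∧
          ∃ g ∈ G, ∃ h ∈ stab G E, g * h * g⁻¹ ∉ stab G E)) ∧
      MinimalAction G ∧
      (¬ ∃ C, IsConic C ∧ ∀ g ∈ G, g C = C) ∧
      CondH1 G := by
  refine ⟨rho.range, ?_, ?_, ⟨psi, chi, psi_injective, chi_ne_one,
    ⟨(MonoidHom.ofInjective rho_injective).symm⟩⟩, ncard_orbs,
    (ncard_orbs_of_ncard 6).trans (by decide), (ncard_orbs_of_ncard 10).trans (by decide),
    (ncard_orbs_of_ncard 30).trans (by decide), fun E hE => stab_of_mem_Exc hE,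
    minimalAction_range_rho, not_exists_fixed_conic, condH1_range_rho⟩
  · rintro _ ⟨h, rfl⟩
    exact rho_mem_W h
  · rw [← Nat.card_congr (MonoidHom.ofInjective rho_injective).toEquiv, card_C3F5]

end
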